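/- Assume the main configuration, with Z ≠ P and no three of A, B, C, P, Z collinear. Let G be a point lying on both Ω and the conic (ABCPZ) with G ∉ {A, B, C}. Then Y, Z, G are collinear, and line DG is parallel to line PZ. -/

import Mathlib

noncomputable section

/-- The line through the points `u` and `v`. -/
def lineThrough (u v : ℂ) : Set ℂ := {z : ℂ | ∃ t : ℝ, z = u + t • (v - u)}

/-- A subset of `ℂ` is a line if it is the line through two distinct points. -/
def IsLine (L : Set ℂ) : Prop := ∃ u v : ℂ, u ≠ v ∧ L = lineThrough u v

/-- The circle with center `O` and radius `r`. -/
def circleSet (O : ℂ) (r : ℝ) : Set ℂ := {z : ℂ | ‖z - O‖ = r}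

/-- The value at `z` of the real quadratic polynomial with coefficients `a, b, c, d, e, f`
in the coordinates `x = Re z`, `y = Im z`. -/
def conicEval (a b c d e f : ℝ) (z : ℂ) : ℝ :=
  a * z.re ^ 2 + b * z.re * z.im + c * z.im ^ 2 + d * z.re + e * z.im + f

/-- The gradient at `z` of the real quadratic polynomial with coefficients
`a, b, c, d, e, f`, regarded as a complex number. -/
def conicGrad (a b c d e f : ℝ) (z : ℂ) : ℂ :=
  ((2 * a * z.re + b * z.im + d : ℝ) : ℂ) + ((b * z.re + 2 * c * z.im + e : ℝ) : ℂ) * Complex.I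

/-- A conic: the zero set of a nonzero real polynomial of total degree at most 2 in the
coordinates `x = Re z`, `y = Im z`. -/
def IsConic (S : Set ℂ) : Prop :=
  ∃ a b c d e f : ℝ, ¬(a = 0 ∧ b = 0 ∧ c = 0 ∧ d = 0 ∧ e = 0 ∧ f = 0) ∧
    S = {z : ℂ | conicEval a b c d e f z = 0}

/-- The line through `Z` perpendicular to the (nonzero) vector `g`. -/
def perpLineAt (Z g : ℂ) : Set ℂ :=
  {w : ℂ | (w - Z).re * g.re + (w - Z).im * g.im = 0}

/-- `L` is the tangent line of the conic `S` at the point `Z`: for some defining polynomial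
`f` of `S` vanishing at `Z` with `∇f(Z) ≠ 0`, `L` is the line through `Z` perpendicular
to `∇f(Z)`. -/
def IsConicTangentLineAt (S : Set ℂ) (Z : ℂ) (L : Set ℂ) : Prop :=
  ∃ a b c d e f : ℝ, ¬(a = 0 ∧ b = 0 ∧ c = 0 ∧ d = 0 ∧ e = 0 ∧ f = 0) ∧
    S = {z : ℂ | conicEval a b c d e f z = 0} ∧
    conicEval a b c d e f Z = 0 ∧ conicGrad a b c d e f Z ≠ 0 ∧
    L = perpLineAt Z (conicGrad a b c d e f Z)

/-- The circle with center `O` and radius `r` and the conic `S` are tangent at `Z`: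
both pass through `Z` and the tangent line of the circle at `Z` (the line through `Z`
perpendicular to the radius) is the tangent line of the conic at `Z`. -/
def CircleConicTangentAt (O : ℂ) (r : ℝ) (S : Set ℂ) (Z : ℂ) : Prop :=
  Z ∈ circleSet O r ∧ Z ∈ S ∧ IsConicTangentLineAt S Z (perpLineAt Z (Z - O))

/-- `P` and `P'` are isogonal conjugates with respect to the triangle `ABC`. -/
def IsogConj (A B C P P' : ℂ) : Prop :=
  ((P - A) * (P' - A) / ((B - A) * (C - A))).im = 0 ∧
  ((P - B) * (P' - B) / ((C - B) * (A - B))).im = 0 ∧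
  ((P - C) * (P' - C) / ((A - C) * (B - C))).im = 0

/-- No three of the points in the list `l` are collinear. -/
def NoThreeCollinear (l : List ℂ) : Prop :=
  ∀ i j k : Fin l.length, i ≠ j → i ≠ k → j ≠ k →
    ¬ Collinear ℝ ({l.get i, l.get j, l.get k} : Set ℂ)

/-- Four points lie on a common circle. -/
def Concyclic4 (A B C D : ℂ) : Prop :=
  ∃ O : ℂ, ∃ r : ℝ, 0 < r ∧ A ∈ circleSet O r ∧ B ∈ circleSet O r ∧
    C ∈ circleSet O r ∧ D ∈ circleSet O r

/-- Orthogonal reflection of `z` across the line through `u` with direction `v`. -/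
def reflAcross (u v z : ℂ) : ℂ :=
  u + v / (starRingEnd ℂ) v * (starRingEnd ℂ) (z - u)

/-- `O'` is a center of `S`: the point reflection about `O'` maps `S` onto itself. -/
def IsCenter (S : Set ℂ) (O' : ℂ) : Prop :=
  (fun z => 2 * O' - z) '' S = S


section Algebra

variable {K : Type*} [Field K]

/-- A cubic polynomial with four distinct roots is zero. -/
lemma cubic_coeffs_eq_zero {k₃ k₂ k₁ k₀ a b c g : K} (hab : a ≠ b) (hac : a ≠ c) (hbc : b ≠ c)
    (hga : g ≠ a) (hgb : g ≠ b) (hgc : g ≠ c)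
    (ha : k₃ * a ^ 3 + k₂ * a ^ 2 + k₁ * a + k₀ = 0)
    (hb : k₃ * b ^ 3 + k₂ * b ^ 2 + k₁ * b + k₀ = 0)
    (hc : k₃ * c ^ 3 + k₂ * c ^ 2 + k₁ * c + k₀ = 0)
    (hg : k₃ * g ^ 3 + k₂ * g ^ 2 + k₁ * g + k₀ = 0) :
    k₃ = 0 ∧ k₂ = 0 ∧ k₁ = 0 ∧ k₀ = 0 := by
  have quot : ∀ u, u ≠ a → k₃ * u ^ 3 + k₂ * u ^ 2 + k₁ * u + k₀ = 0 →
      k₃ * (u ^ 2 + a * u + a ^ 2) + k₂ * (u + a) + k₁ = 0 := fun u hu h =>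
    mul_left_cancel₀ (sub_ne_zero.2 hu) (by linear_combination h - ha)
  have qb := quot b hab.symm hb
  have qc := quot c hac.symm hc
  have qg := quot g hga hg
  have sc : k₃ * (a + b + c) + k₂ = 0 :=
    mul_left_cancel₀ (sub_ne_zero.2 hbc) (by linear_combination qb - qc)
  have sg : k₃ * (a + b + g) + k₂ = 0 :=
    mul_left_cancel₀ (sub_ne_zero.2 hgb) (by linear_combination qg - qb)
  have h₃ : k₃ = 0 := mul_left_cancel₀ (sub_ne_zero.2 hgc) (by linear_combination sg - sc)
  subst h₃
  have h₂ : k₂ = 0 := by linear_combination sc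
  subst h₂
  have h₁ : k₁ = 0 := by linear_combination qb
  subst h₁
  exact ⟨rfl, rfl, rfl, by linear_combination ha⟩

/-- The value at the point with conjugate coordinates `p, q` of a conic meeting the unit circle
in `a, b, c, g`; the other such conics differ from it by a multiple of `p * q - 1`. -/
def pencilForm (a b c g p q : K) : K :=
  p ^ 2 + a * b * c * g * q ^ 2 - (a + b + c + g) * p
    - (a * b * c + (a * b + a * c + b * c) * g) * q + (a * b + a * c + b * c + (a + b + c) * g)

/-- A quadratic polynomial in conjugate coordinates. -/
def quadForm (k : Fin 6 → K) (p q : K) : K :=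
  k 0 * p ^ 2 + k 1 * p * q + k 2 * q ^ 2 + k 3 * p + k 4 * q + k 5

lemma pencilForm_relation {k : Fin 6 → K} (hk : k ≠ 0) {a b c g p p' z z' : K}
    (ha0 : a ≠ 0) (hb0 : b ≠ 0) (hc0 : c ≠ 0) (hg0 : g ≠ 0)
    (hab : a ≠ b) (hac : a ≠ c) (hbc : b ≠ c) (hga : g ≠ a) (hgb : g ≠ b) (hgc : g ≠ c)
    (ha : quadForm k a a⁻¹ = 0) (hb : quadForm k b b⁻¹ = 0) (hc : quadForm k c c⁻¹ = 0)
    (hg : quadForm k g g⁻¹ = 0) (hp : quadForm k p p' = 0) (hz : quadForm k z z' = 0)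
    (hpp : p * p' ≠ 1) :
    pencilForm a b c g p p' * (z * z' - 1) = pencilForm a b c g z z' * (p * p' - 1) := by
  have quartic : ∀ u : K, u ≠ 0 → quadForm k u u⁻¹ = 0 →
      k 0 * u ^ 4 + k 3 * u ^ 3 + (k 1 + k 5) * u ^ 2 + k 4 * u + k 2 = 0 := by
    intro u hu h
    unfold quadForm at h
    field_simp at h
    linear_combination h
  have key : ∀ u : K, u ≠ 0 → (u - a) * (u - b) * (u - c) * (u - g) = 0 →
      quadForm k u u⁻¹ = 0 →
      (k 3 + k 0 * (a + b + c + g)) * u ^ 3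
        + (k 1 + k 5 - k 0 * (a * b + a * c + b * c + (a + b + c) * g)) * u ^ 2
        + (k 4 + k 0 * (a * b * c + (a * b + a * c + b * c) * g)) * u
        + (k 2 - k 0 * (a * b * c * g)) = 0 := by
    intro u hu hr h
    linear_combination quartic u hu h - k 0 * hr
  obtain ⟨h₃, h₂, h₁, h₀⟩ := cubic_coeffs_eq_zero hab hac hbc hga hgb hgc
    (key a ha0 (by ring) ha) (key b hb0 (by ring) hb) (key c hc0 (by ring) hc)
    (key g hg0 (by ring) hg)
  have form : ∀ u u' : K,
      quadForm k u u' = k 0 * pencilForm a b c g u u' + k 1 * (u * u' - 1) := by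
    intro u u'
    unfold quadForm pencilForm
    linear_combination u * h₃ + h₂ + u' * h₁ + u' ^ 2 * h₀
  rw [form] at hp hz
  have hk0 : k 0 ≠ 0 := by
    intro h
    rw [h, zero_mul, zero_add] at hp
    have hk1 : k 1 = 0 := (mul_eq_zero.1 hp).resolve_right (sub_ne_zero.2 hpp)
    apply hk
    funext i
    fin_cases i <;> simp_all
  exact mul_left_cancel₀ hk0 (by linear_combination (z * z' - 1) * hp - (p * p' - 1) * hz)

/-- Otherwise the conic made of the lines `ab` and `cp` would contain `z`. -/
lemma pencilForm_relation_unique {a b c g g' p p' z z' : K} (hpp : p * p' ≠ 1)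
    (habz : z + a * b * z' - a - b ≠ 0)
    (hcpz : (z - c) * (c * p' - 1) + (c - p) * (c * z' - 1) ≠ 0)
    (hg : pencilForm a b c g p p' * (z * z' - 1) = pencilForm a b c g z z' * (p * p' - 1))
    (hg' : pencilForm a b c g' p p' * (z * z' - 1) = pencilForm a b c g' z z' * (p * p' - 1)) :
    g = g' := by
  by_contra hne
  set N := (a * b * c * p' ^ 2 - p - (a * b + a * c + b * c) * p' + (a + b + c)) * (z * z' - 1)
    - (a * b * c * z' ^ 2 - z - (a * b + a * c + b * c) * z' + (a + b + c)) * (p * p' - 1)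
    with hNdef
  have hN : N = 0 := by
    refine mul_left_cancel₀ (sub_ne_zero.2 hne) ?_
    unfold pencilForm at hg hg'
    rw [hNdef]
    linear_combination hg - hg'
  have line_pair : (z + a * b * z' - a - b)
      * ((z - c) * (c * p' - 1) + (c - p) * (c * z' - 1)) = 0 := by
    refine mul_left_cancel₀ (sub_ne_zero.2 hpp) ?_
    unfold pencilForm at hg
    rw [hNdef] at hN
    linear_combination (-(c * p' - 1)) * hg + ((c * p' - 1) * g - (c - p)) * hN
  exact (mul_ne_zero habz hcpz) line_pair

/-- The fourth intersection of the unit circle with the conic through a triangle inscribed in it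
and two isogonal conjugates is determined by the direction of the line joining the conjugates. -/
lemma direction_of_isogonal_conic {a b c d p p' q q' : K}
    (hs₁ : a + b + c = p + q + a * b * c * p' * q')
    (hs₂ : a * b + a * c + b * c = a * b * c * (p' + q') + p * q)
    (hpp : p * p' ≠ 1) (hqq : q * q' ≠ 1)
    (h : pencilForm a b c d p p' * (q * q' - 1) = pencilForm a b c d q q' * (p * p' - 1)) :
    d * (p - q) + a * b * c * (p' - q') = 0 := by
  refine mul_left_cancel₀ (mul_ne_zero (sub_ne_zero.2 hpp) (sub_ne_zero.2 hqq)) ?_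
  unfold pencilForm at h
  rw [hs₁, hs₂] at h
  linear_combination h

lemma pencilForm_relation_of_collinear {a b c d y g p p' q q' z z' : K}
    (hs₁ : a + b + c = p + q + a * b * c * p' * q')
    (hs₂ : a * b + a * c + b * c = a * b * c * (p' + q') + p * q) (hd : d ≠ 0)
    (hg : g * d ^ 2 = a * b * c)
    (hpq : d * (p - q) + a * b * c * (p' - q') = 0)
    (hpz : d * (z - p) + a * b * c * (z' - p') = 0)
    (hy : y * (d * q' - 1) = d - q)
    (hyz : z + y * g * z' = y + g) :
    pencilForm a b c g p p' * (z * z' - 1) = pencilForm a b c g z z' * (p * p' - 1) := by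
  unfold pencilForm
  rw [hs₁, hs₂, ← hg]
  rw [← hg] at hpq hpz
  have hR : z * (d * q' - 1) + (d - q) * g * z' = d - q + g * (d * q' - 1) := by
    linear_combination (d * q' - 1) * hyz - (g * z' - 1) * hy
  have hq : q = p + g * d * (p' - q') :=
    mul_left_cancel₀ hd (by linear_combination -hpq)
  have hz : z = p - g * d * (z' - p') :=
    mul_left_cancel₀ hd (by linear_combination hpz)
  subst hq hz
  linear_combination (-(p * p' - 1)) * g * d * (z' - p') * hR

/-- Reim's theorem for the circle through `p, x, y, z` and the unit circle. -/
lemma reim {s d x y p p' z z' o o' ρ : K} (hd : d ≠ 0) (hx0 : x ≠ 0) (hy0 : y ≠ 0)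
    (hp : (p - o) * (p' - o') = ρ) (hx : (x - o) * (x⁻¹ - o') = ρ)
    (hy : (y - o) * (y⁻¹ - o') = ρ) (hz : (z - o) * (z' - o') = ρ)
    (hxd : x * (d * p' - 1) = d - p) (hline : d * (z - p) + s * (z' - p') = 0) (hzp : z ≠ p)
    (hxyp : (x - p) * (y⁻¹ - p') - (x⁻¹ - p') * (y - p) ≠ 0) :
    z * d ^ 2 + y * s * z' = y * d ^ 2 + s := by
  have hxp' : x⁻¹ - p' = - (x - p) / (x * d) := by
    field_simp; linear_combination -hxd
  have hxp : x - p ≠ 0 := by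
    intro h; rw [hxp', h] at hxyp; simp at hxyp
  have hK : x * d * (1 - y * p') + y * (y - p) ≠ 0 := by
    intro h
    apply hxyp
    rw [hxp']
    field_simp
    linear_combination (x - p) * h
  have ex : (p' - o') * x * d - (p - o) = x - p := by
    refine mul_left_cancel₀ hxp ?_
    have : (x - p) * (x⁻¹ - p') + (p - o) * (x⁻¹ - p') + (p' - o') * (x - p) = 0 := by
      linear_combination hx - hp
    rw [hxp'] at this
    field_simp at this
    linear_combination this
  have ez : d * (z - p) = (p' - o') * s - d * (p - o) := by
    refine mul_left_cancel₀ (sub_ne_zero.2 hzp) ?_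
    linear_combination (z - o) * hline - s * (hz - hp)
  have ey : (1 - y * p') * (y - p) + (p - o) * (1 - y * p') + (p' - o') * y * (y - p) = 0 := by
    have : y * y⁻¹ = 1 := mul_inv_cancel₀ hy0
    linear_combination y * (hy - hp) - (y - o) * this
  have en : (p' - o') * (x * d * (1 - y * p') + y * (y - p)) = (1 - y * p') * (x - y) := by
    linear_combination ey + (1 - y * p') * ex
  have eK : x * d * (1 - y * p') + y * (y - p) = (x - y) * (d - y) := by
    linear_combination -y * hxd
  rw [eK] at en hK
  have ew : (x - y) * (d - y) * (d * (z - p))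
      = (1 - y * p') * (x - y) * (s - d ^ 2 * x) + d * (x - p) * ((x - y) * (d - y)) := by
    linear_combination (x - y) * (d - y) * (ez + d * ex) + (s - d ^ 2 * x) * en
  refine mul_left_cancel₀ hK ?_
  linear_combination (x - y) * (d - y) * y * hline + (d - y) * ew
    + (x - y) * (d - y) * d * y * hxd

/-- A point with an isogonal conjugate lies on the unit circle only if it is a vertex. -/
lemma mul_ne_one_of_isogonal {a b c p p' q q' : K}
    (hs₁ : a + b + c = p + q + a * b * c * p' * q')
    (hs₂ : a * b + a * c + b * c = a * b * c * (p' + q') + p * q)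
    (hpa : p ≠ a) (hpb : p ≠ b) (hpc : p ≠ c) : p * p' ≠ 1 := by
  intro h
  have : (p - a) * (p - b) * (p - c) = 0 := by
    linear_combination -p ^ 2 * hs₁ + p * hs₂ + a * b * c * (1 - p * q') * h
  simp_all [sub_eq_zero]

end Algebra

open scoped ComplexConjugate

lemma exists_real_smul_of_mul_conj_eq {u w : ℂ} (hw : w ≠ 0) (h : u * conj w = w * conj u) :
    ∃ t : ℝ, u = t • w := by
  have hw' : conj w ≠ 0 := by simpa using hw
  have hreal : conj (u / w) = u / w := by
    rw [map_div₀]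
    field_simp
    linear_combination -h
  obtain ⟨t, ht⟩ := Complex.conj_eq_iff_real.1 hreal
  exact ⟨t, by rw [Complex.real_smul, ← ht]; field_simp⟩

lemma collinear_iff_mul_conj_eq {x y z : ℂ} :
    Collinear ℝ ({x, y, z} : Set ℂ) ↔ (y - x) * conj (z - x) = (z - x) * conj (y - x) := by
  rw [collinear_iff_of_mem (p₀ := x) (by simp)]
  constructor
  · rintro ⟨v, h⟩
    obtain ⟨s, hs⟩ := h y (by simp)
    obtain ⟨t, ht⟩ := h z (by simp)
    subst hs ht
    simp
    ring
  · intro h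
    by_cases hy : y = x
    · refine ⟨z - x, ?_⟩
      rintro w (rfl | rfl | rfl)
      · exact ⟨0, by simp⟩
      · exact ⟨0, by simp [hy]⟩
      · exact ⟨1, by simp⟩
    · obtain ⟨t, ht⟩ := exists_real_smul_of_mul_conj_eq (sub_ne_zero.2 hy) h.symm
      refine ⟨y - x, ?_⟩
      rintro w (rfl | rfl | rfl)
      · exact ⟨0, by simp⟩
      · exact ⟨1, by simp⟩
      · exact ⟨t, by rw [← ht]; simp⟩

lemma collinear_add_mul_iff (O : ℂ) {r : ℝ} (hr : 0 < r) {x y z : ℂ} :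
    Collinear ℝ ({O + r * x, O + r * y, O + r * z} : Set ℂ) ↔ Collinear ℝ ({x, y, z} : Set ℂ) := by
  have hr' : (r : ℂ) ^ 2 ≠ 0 := by exact_mod_cast (pow_pos hr 2).ne'
  simp only [collinear_iff_mul_conj_eq]
  conv_rhs => rw [← mul_right_inj' hr']
  simp only [map_sub, map_add, map_mul, Complex.conj_ofReal]
  constructor <;> intro h <;> linear_combination h

lemma mem_circleSet_add_mul_iff (O : ℂ) {r : ℝ} (hr : 0 < r) {u : ℂ} :
    O + r * u ∈ circleSet O r ↔ ‖u‖ = 1 := by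
  simp [circleSet, abs_of_pos hr, hr.ne']

lemma conicEval_coeffs_eq_zero {a b c d e f : ℝ} (h : ∀ z, conicEval a b c d e f z = 0) :
    a = 0 ∧ b = 0 ∧ c = 0 ∧ d = 0 ∧ e = 0 ∧ f = 0 := by
  have h₀ := h 0
  have h₁ := h 1
  have h₂ := h (-1)
  have h₃ := h Complex.I
  have h₄ := h (-Complex.I)
  have h₅ := h (1 + Complex.I)
  simp [conicEval] at h₀ h₁ h₂ h₃ h₄ h₅
  refine ⟨?_, ?_, ?_, ?_, ?_, ?_⟩ <;> linarith

lemma IsConic.exists_quadForm {S : Set ℂ} (hS : IsConic S) (O : ℂ) {r : ℝ} (hr : 0 < r) :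
    ∃ k : Fin 6 → ℂ, k ≠ 0 ∧ ∀ u : ℂ, O + r * u ∈ S → quadForm k u (conj u) = 0 := by
  obtain ⟨a, b, c, d, e, f, hne, rfl⟩ := hS
  have hr' : (r : ℂ) ≠ 0 := by exact_mod_cast hr.ne'
  set k : Fin 6 → ℂ := ![(r / 2) ^ 2 * (a - c - b * Complex.I), 2 * (r / 2) ^ 2 * (a + c),
    (r / 2) ^ 2 * (a - c + b * Complex.I),
    r / 2 * (2 * a * O.re + b * O.im + d - (b * O.re + 2 * c * O.im + e) * Complex.I),
    r / 2 * (2 * a * O.re + b * O.im + d + (b * O.re + 2 * c * O.im + e) * Complex.I),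
    conicEval a b c d e f O] with hk
  have form : ∀ u, (conicEval a b c d e f (O + r * u) : ℂ) = quadForm k u (conj u) := by
    intro u
    apply Complex.ext <;> simp [hk, quadForm, conicEval, pow_two] <;> ring
  refine ⟨k, fun h0 => hne (conicEval_coeffs_eq_zero fun z => ?_), fun u hu => ?_⟩
  · have := form ((z - O) / r)
    rw [mul_div_cancel₀ _ hr', add_sub_cancel, h0] at this
    simpa [quadForm] using this
  · have hu' : conicEval a b c d e f (O + r * u) = 0 := hu
    rw [← form u, hu', Complex.ofReal_zero]

lemma isogonal_at_vertex {a b c p q : ℂ} (ha : ‖a‖ = 1) (hb : ‖b‖ = 1) (hc : ‖c‖ = 1)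
    (hab : a ≠ b) (hac : a ≠ c)
    (h : ((p - a) * (q - a) / ((b - a) * (c - a))).im = 0) :
    (p - a) * (q - a) = (a * conj p - 1) * (a * conj q - 1) * (b * c) := by
  have unit : ∀ u : ℂ, ‖u‖ = 1 → u ≠ 0 ∧ conj u = u⁻¹ := fun u hu =>
    ⟨norm_ne_zero_iff.1 (by simp [hu]), (Complex.inv_eq_conj hu).symm⟩
  obtain ⟨ha0, ha⟩ := unit a ha
  obtain ⟨hb0, hb⟩ := unit b hb
  obtain ⟨hc0, hc⟩ := unit c hc
  have hba : b - a ≠ 0 := sub_ne_zero.2 hab.symm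
  have hca : c - a ≠ 0 := sub_ne_zero.2 hac.symm
  have h' := Complex.conj_eq_iff_im.2 h
  have ebc : (b⁻¹ - a⁻¹) * (c⁻¹ - a⁻¹) = (b - a) * (c - a) / (a ^ 2 * b * c) := by
    field_simp; ring
  simp only [map_div₀, map_mul, map_sub, ha, hb, hc, ebc] at h'
  field_simp at h'
  linear_combination -h'

lemma isogonal_relations {a b c p q : ℂ} (ha : ‖a‖ = 1) (hb : ‖b‖ = 1) (hc : ‖c‖ = 1)
    (hab : a ≠ b) (hac : a ≠ c) (hbc : b ≠ c) (h : IsogConj a b c p q) :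
    a + b + c = p + q + a * b * c * conj p * conj q ∧
      a * b + a * c + b * c = a * b * c * (conj p + conj q) + p * q := by
  have eA := isogonal_at_vertex ha hb hc hab hac h.1
  have eB := isogonal_at_vertex hb hc ha hbc hab.symm h.2.1
  have h₁ : a + b + c = p + q + a * b * c * conj p * conj q :=
    mul_left_cancel₀ (sub_ne_zero.2 hab) (by linear_combination eA - eB)
  exact ⟨h₁, by linear_combination a * h₁ - eA⟩

lemma second_intersection {d x p : ℂ} (hd : ‖d‖ = 1) (hx : ‖x‖ = 1) (hxd : x ≠ d)
    (h : x ∈ lineThrough d p) : x * (d * conj p - 1) = d - p := by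
  have hd0 : d ≠ 0 := norm_ne_zero_iff.1 (by simp [hd])
  have hx0 : x ≠ 0 := norm_ne_zero_iff.1 (by simp [hx])
  obtain ⟨t, ht⟩ := h
  rw [Complex.real_smul] at ht
  have ht0 : (t : ℂ) ≠ 0 := by
    intro h0
    exact hxd (by rw [ht, h0]; ring)
  have ht' := congrArg conj ht
  simp only [map_add, map_mul, map_sub, Complex.conj_ofReal, ← Complex.inv_eq_conj hd,
    ← Complex.inv_eq_conj hx] at ht'
  refine mul_left_cancel₀ ht0 ?_
  field_simp at ht'
  linear_combination -ht - ht'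

lemma circle_equation_of_mem {O o u : ℂ} {r ρ : ℝ} (hr : 0 < r)
    (h : O + r * u ∈ circleSet (O + r * o) ρ) :
    (u - o) * (conj u - conj o) = (ρ / r : ℂ) ^ 2 := by
  have hr' : (r : ℂ) ≠ 0 := by exact_mod_cast hr.ne'
  have h' : ‖O + r * u - (O + r * o)‖ = ρ := h
  have hsq := Complex.mul_conj' (O + r * u - (O + r * o))
  rw [h'] at hsq
  simp only [map_sub, map_add, map_mul, Complex.conj_ofReal] at hsq
  field_simp
  linear_combination hsq

lemma mem_lineThrough_add_mul_iff (O : ℂ) {r : ℝ} (hr : 0 < r) {u v w : ℂ} :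
    O + r * w ∈ lineThrough (O + r * u) (O + r * v) ↔ w ∈ lineThrough u v := by
  have hr' : (r : ℂ) ≠ 0 := by exact_mod_cast hr.ne'
  refine exists_congr fun t => ?_
  simp only [Complex.real_smul]
  constructor <;> intro h
  · refine mul_left_cancel₀ hr' ?_
    linear_combination h
  · linear_combination r * h

lemma isogConj_add_mul_iff (O : ℂ) {r : ℝ} (hr : 0 < r) {a b c p q : ℂ} :
    IsogConj (O + r * a) (O + r * b) (O + r * c) (O + r * p) (O + r * q) ↔
      IsogConj a b c p q := by
  have hr' : (r : ℂ) ≠ 0 := by exact_mod_cast hr.ne'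
  have ratio : ∀ u v w s t : ℂ,
      (O + r * u - (O + r * v)) * (O + r * w - (O + r * v))
        / ((O + r * s - (O + r * v)) * (O + r * t - (O + r * v)))
      = (u - v) * (w - v) / ((s - v) * (t - v)) := by
    intro u v w s t
    rw [← mul_div_mul_left _ _ (pow_ne_zero 2 hr')]
    conv_rhs => rw [← mul_div_mul_left _ _ (pow_ne_zero 4 hr')]
    congr 1 <;> ring
  simp only [IsogConj, ratio]

lemma ne_of_not_collinear {x y z : ℂ} (h : ¬ Collinear ℝ ({x, y, z} : Set ℂ)) :
    x ≠ y ∧ x ≠ z ∧ y ≠ z := by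
  refine ⟨?_, ?_, ?_⟩ <;> rintro rfl <;> apply h <;> simp [collinear_pair]

lemma NoThreeCollinear.not_collinear {A B C P Q : ℂ} (h : NoThreeCollinear [A, B, C, P, Q]) :
    ¬ Collinear ℝ ({A, B, P} : Set ℂ) ∧ ¬ Collinear ℝ ({A, C, P} : Set ℂ) ∧
    ¬ Collinear ℝ ({A, B, Q} : Set ℂ) ∧ ¬ Collinear ℝ ({A, C, Q} : Set ℂ) ∧
    ¬ Collinear ℝ ({C, P, Q} : Set ℂ) := by
  have key : ∀ i j k : Fin 5, i ≠ j → i ≠ k → j ≠ k →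
      ¬ Collinear ℝ ({[A, B, C, P, Q].get i, [A, B, C, P, Q].get j,
        [A, B, C, P, Q].get k} : Set ℂ) := h
  exact ⟨key 0 1 3 (by decide) (by decide) (by decide),
    key 0 2 3 (by decide) (by decide) (by decide), key 0 1 4 (by decide) (by decide) (by decide),
    key 0 2 4 (by decide) (by decide) (by decide), key 2 3 4 (by decide) (by decide) (by decide)⟩

/-- The theorem for the unit circle, in conjugate coordinates. -/
theorem collinear_and_parallel_of_unit_circle {a b c d x y g p q z o ρ : ℂ} {k l : Fin 6 → ℂ}
    (ha : ‖a‖ = 1) (hb : ‖b‖ = 1) (hc : ‖c‖ = 1) (hd : ‖d‖ = 1) (hx : ‖x‖ = 1) (hy : ‖y‖ = 1)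
    (hg : ‖g‖ = 1) (hab : a ≠ b) (hac : a ≠ c) (hbc : b ≠ c)
    (hda : d ≠ a) (hdb : d ≠ b) (hdc : d ≠ c) (hga : g ≠ a) (hgb : g ≠ b) (hgc : g ≠ c)
    (hpa : p ≠ a) (hpb : p ≠ b) (hpc : p ≠ c) (hqa : q ≠ a) (hqb : q ≠ b) (hqc : q ≠ c)
    (hisog : IsogConj a b c p q)
    (hk : k ≠ 0) (hka : quadForm k a (conj a) = 0) (hkb : quadForm k b (conj b) = 0)
    (hkc : quadForm k c (conj c) = 0) (hkd : quadForm k d (conj d) = 0)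
    (hkp : quadForm k p (conj p) = 0) (hkq : quadForm k q (conj q) = 0)
    (hl : l ≠ 0) (hla : quadForm l a (conj a) = 0) (hlb : quadForm l b (conj b) = 0)
    (hlc : quadForm l c (conj c) = 0) (hlg : quadForm l g (conj g) = 0)
    (hlp : quadForm l p (conj p) = 0) (hlz : quadForm l z (conj z) = 0)
    (hxd : x ≠ d) (hxp : x ∈ lineThrough d p) (hyd : y ≠ d) (hyq : y ∈ lineThrough d q)
    (hpxy : ¬ Collinear ℝ ({p, x, y} : Set ℂ))
    (hop : (p - o) * (conj p - conj o) = ρ) (hox : (x - o) * (conj x - conj o) = ρ)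
    (hoy : (y - o) * (conj y - conj o) = ρ) (hoz : (z - o) * (conj z - conj o) = ρ)
    (hzp : z ≠ p) (hz : z ∈ lineThrough p q)
    (habz : ¬ Collinear ℝ ({a, b, z} : Set ℂ)) (hcpz : ¬ Collinear ℝ ({c, p, z} : Set ℂ)) :
    Collinear ℝ ({y, z, g} : Set ℂ) ∧ ∃ t : ℝ, g - d = t • (z - p) := by
  obtain ⟨hs₁, hs₂⟩ := isogonal_relations ha hb hc hab hac hbc hisog
  have exd := second_intersection hd hx hxd hxp
  have eyd := second_intersection hd hy hyd hyq
  have unit : ∀ u : ℂ, ‖u‖ = 1 → u ≠ 0 ∧ conj u = u⁻¹ := fun u hu =>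
    ⟨norm_ne_zero_iff.1 (by simp [hu]), (Complex.inv_eq_conj hu).symm⟩
  obtain ⟨ha0, ha⟩ := unit a ha
  obtain ⟨hb0, hb⟩ := unit b hb
  obtain ⟨hc0, hc⟩ := unit c hc
  obtain ⟨hd0, hd⟩ := unit d hd
  obtain ⟨hx0, hx⟩ := unit x hx
  obtain ⟨hy0, hy⟩ := unit y hy
  obtain ⟨hg0, hg⟩ := unit g hg
  rw [collinear_iff_mul_conj_eq] at hpxy habz hcpz ⊢
  simp only [map_sub, ha, hb, hc, hd, hx, hy, hg]
    at hka hkb hkc hkd hla hlb hlc hlg hox hoy hpxy habz hcpz ⊢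
  have hpp := mul_ne_one_of_isogonal hs₁ hs₂ hpa hpb hpc
  have hqq := mul_ne_one_of_isogonal (p := q) (p' := conj q) (q := p) (q' := conj p)
    (by linear_combination hs₁) (by linear_combination hs₂) hqa hqb hqc
  have hpq := direction_of_isogonal_conic hs₁ hs₂ hpp hqq
    (pencilForm_relation hk ha0 hb0 hc0 hd0 hab hac hbc hda hdb hdc hka hkb hkc hkd hkp hkq hpp)
  have hpz : d * (z - p) + a * b * c * (conj z - conj p) = 0 := by
    obtain ⟨t, rfl⟩ := hz
    simp only [Complex.real_smul, map_add, map_sub, map_mul, Complex.conj_ofReal]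
    linear_combination (-t : ℂ) * hpq
  have hreim := reim hd0 hx0 hy0 hop hox hoy hoz exd hpz hzp
    (fun h => hpxy (by linear_combination h))
  have hyz₀ : z + y * (a * b * c / d ^ 2) * conj z = y + a * b * c / d ^ 2 := by
    field_simp
    linear_combination hreim
  have hgd : g = a * b * c / d ^ 2 := by
    refine pencilForm_relation_unique hpp ?_ ?_
      (pencilForm_relation hl ha0 hb0 hc0 hg0 hab hac hbc hga hgb hgc hla hlb hlc hlg hlp hlz hpp)
      (pencilForm_relation_of_collinear hs₁ hs₂ hd0 (by field_simp) hpq hpz eyd hyz₀)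
    · intro h
      apply habz
      field_simp
      linear_combination (b - a) * h
    · intro h
      apply hcpz
      field_simp
      linear_combination -h
  rw [← hgd] at hyz₀
  constructor
  · field_simp
    linear_combination (y - g) * hyz₀
  · apply exists_real_smul_of_mul_conj_eq (sub_ne_zero.2 hzp)
    have hgs : g * d ^ 2 = a * b * c := by rw [hgd]; field_simp
    simp only [map_sub, hg, hd]
    rw [← hgs] at hpz
    have : z - p = - (g * d * (conj z - conj p)) :=
      mul_left_cancel₀ hd0 (by linear_combination hpz)
    rw [this]
    field_simp
    ring

theorem statement15
    (A B C O : ℂ) (r : ℝ) (Ω : Set ℂ)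
    (hr : 0 < r) (hΩ : Ω = circleSet O r)
    (hAΩ : A ∈ Ω) (hBΩ : B ∈ Ω) (hCΩ : C ∈ Ω)
    (hABC : ¬ Collinear ℝ ({A, B, C} : Set ℂ))
    (P P' : ℂ) (hPP' : P ≠ P') (hconj : IsogConj A B C P P')
    (h5 : NoThreeCollinear [A, B, C, P, P'])
    (H : Set ℂ) (hH : IsConic H)
    (hAH : A ∈ H) (hBH : B ∈ H) (hCH : C ∈ H) (hPH : P ∈ H) (hP'H : P' ∈ H)
    (D : ℂ) (hDΩ : D ∈ Ω) (hDH : D ∈ H) (hDA : D ≠ A) (hDB : D ≠ B) (hDC : D ≠ C)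
    (hDP : D ≠ P) (hDP' : D ≠ P')
    (X : ℂ) (hXD : X ≠ D) (hXΩ : X ∈ Ω) (hXline : X ∈ lineThrough D P)
    (Y : ℂ) (hYD : Y ≠ D) (hYΩ : Y ∈ Ω) (hYline : Y ∈ lineThrough D P')
    (hPXY : ¬ Collinear ℝ ({P, X, Y} : Set ℂ))
    (O₁ : ℂ) (r₁ : ℝ) (hr₁ : 0 < r₁)
    (hPγ : P ∈ circleSet O₁ r₁) (hXγ : X ∈ circleSet O₁ r₁) (hYγ : Y ∈ circleSet O₁ r₁)
    (Z : ℂ) (hZP : Z ≠ P) (hZγ : Z ∈ circleSet O₁ r₁) (hZline : Z ∈ lineThrough P P')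
    (h5Z : NoThreeCollinear [A, B, C, P, Z])
    (E : Set ℂ) (hE : IsConic E)
    (hAE : A ∈ E) (hBE : B ∈ E) (hCE : C ∈ E) (hPE : P ∈ E) (hZE : Z ∈ E)
    (G : ℂ) (hGΩ : G ∈ Ω) (hGE : G ∈ E) (hGA : G ≠ A) (hGB : G ≠ B) (hGC : G ≠ C) :
    Collinear ℝ ({Y, Z, G} : Set ℂ) ∧ ∃ t : ℝ, G - D = t • (Z - P) := by
  have hr' : (r : ℂ) ≠ 0 := by exact_mod_cast hr.ne'
  have coord : ∀ W : ℂ, ∃ w, W = O + r * w := fun W => ⟨(W - O) / r, by field_simp; ring⟩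
  obtain ⟨a, rfl⟩ := coord A
  obtain ⟨b, rfl⟩ := coord B
  obtain ⟨c, rfl⟩ := coord C
  obtain ⟨p, rfl⟩ := coord P
  obtain ⟨q, rfl⟩ := coord P'
  obtain ⟨d, rfl⟩ := coord D
  obtain ⟨x, rfl⟩ := coord X
  obtain ⟨y, rfl⟩ := coord Y
  obtain ⟨z, rfl⟩ := coord Z
  obtain ⟨g, rfl⟩ := coord G
  obtain ⟨o, rfl⟩ := coord O₁
  obtain ⟨k, hk, hkS⟩ := hH.exists_quadForm O hr
  obtain ⟨l, hl, hlS⟩ := hE.exists_quadForm O hr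
  obtain ⟨habp, hacp, habq, hacq, -⟩ := h5.not_collinear
  obtain ⟨-, -, habz, -, hcpz⟩ := h5Z.not_collinear
  subst hΩ
  rw [collinear_add_mul_iff O hr] at hABC habp hacp habq hacq habz hcpz hPXY ⊢
  rw [mem_circleSet_add_mul_iff O hr] at hAΩ hBΩ hCΩ hDΩ hXΩ hYΩ hGΩ
  rw [mem_lineThrough_add_mul_iff O hr] at hXline hYline hZline
  rw [isogConj_add_mul_iff O hr] at hconj
  have hne : ∀ {u v : ℂ}, O + r * u ≠ O + r * v → u ≠ v := fun h e => h (by rw [e])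
  obtain ⟨hab, hac, hbc⟩ := ne_of_not_collinear hABC
  obtain ⟨-, hap, hbp⟩ := ne_of_not_collinear habp
  obtain ⟨-, -, hcp⟩ := ne_of_not_collinear hacp
  obtain ⟨-, haq, hbq⟩ := ne_of_not_collinear habq
  obtain ⟨-, -, hcq⟩ := ne_of_not_collinear hacq
  obtain ⟨hcol, t, ht⟩ := collinear_and_parallel_of_unit_circle hAΩ hBΩ hCΩ hDΩ hXΩ hYΩ hGΩ
    hab hac hbc (hne hDA) (hne hDB) (hne hDC) (hne hGA) (hne hGB) (hne hGC)
    hap.symm hbp.symm hcp.symm haq.symm hbq.symm hcq.symm hconj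
    hk (hkS a hAH) (hkS b hBH) (hkS c hCH) (hkS d hDH) (hkS p hPH) (hkS q hP'H)
    hl (hlS a hAE) (hlS b hBE) (hlS c hCE) (hlS g hGE) (hlS p hPE) (hlS z hZE)
    (hne hXD) hXline (hne hYD) hYline hPXY
    (circle_equation_of_mem hr hPγ) (circle_equation_of_mem hr hXγ)
    (circle_equation_of_mem hr hYγ) (circle_equation_of_mem hr hZγ)
    (hne hZP) hZline habz hcpz
  refine ⟨hcol, t, ?_⟩
  rw [Complex.real_smul] at ht ⊢
  linear_combination r * ht

end
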